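/- arXiv:1904.02853 — 15 statements merged into one kernel-verified Lean document; each statement's English description precedes it below -/
import Mathlib

section
/- Let x : ℤ → ℂ be a sequence satisfying x_{n-1}·x_n·x_{n+1} = x_{n-1} + 1 + x_{n+1} for all n ∈ ℤ, and suppose x_n·x_{n+1} ≠ 1 for all n ∈ ℤ. Then x is periodic with period 5, i.e., x_{n+5} = x_n for all n ∈ ℤ. -/
/-- Away from `x n * x (n + 1) = 1`, the recurrence
`x (n - 1) * x n * x (n + 1) = x (n - 1) + 1 + x (n + 1)` integrates to
`x (n + 3) = x n * x (n + 1) - 1`. -/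
theorem add_three_eq_mul_sub_one {R : Type*} [CommRing R] [IsDomain R] (x : ℤ → R)
    (hrec : ∀ n : ℤ, x (n - 1) * x n * x (n + 1) = x (n - 1) + 1 + x (n + 1))
    (hne : ∀ n : ℤ, x n * x (n + 1) ≠ 1) (n : ℤ) :
    x (n + 3) = x n * x (n + 1) - 1 := by
  have h₁ := hrec (n + 1)
  have h₂ := hrec (n + 2)
  have h₃ := hne (n + 1)
  rw [show n + 1 - 1 = n by ring, show n + 1 + 1 = n + 2 by ring] at h₁
  rw [show n + 2 - 1 = n + 1 by ring, show n + 2 + 1 = n + 3 by ring] at h₂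
  rw [show n + 1 + 1 = n + 2 by ring] at h₃
  apply mul_left_cancel₀ (sub_ne_zero.mpr h₃)
  linear_combination h₂ - x (n + 1) * h₁

/-- The difference equation `x_{n-1} x_n x_{n+1} = x_{n-1} + 1 + x_{n+1}` (the case
`β = 1`, finite type `A₂`) is periodic with period 5. -/
theorem stmt_0 (x : ℤ → ℂ)
    (hrec : ∀ n : ℤ, x (n - 1) * x n * x (n + 1) = x (n - 1) + 1 + x (n + 1))
    (hne : ∀ n : ℤ, x n * x (n + 1) ≠ 1) :
    ∀ n : ℤ, x (n + 5) = x n := by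
  intro n
  have h₁ := hrec (n + 1)
  have h₂ := add_three_eq_mul_sub_one x hrec hne n
  have h₃ := add_three_eq_mul_sub_one x hrec hne (n + 2)
  rw [show n + 1 - 1 = n by ring, show n + 1 + 1 = n + 2 by ring] at h₁
  rw [show n + 2 + 3 = n + 5 by ring, show n + 2 + 1 = n + 3 by ring] at h₃
  linear_combination h₃ + x (n + 2) * h₂ + h₁
end

section
/- Let x : ℤ → ℂ be a sequence satisfying x_{n-1}·x_n·x_{n+1} = x_{n-1} + x_n + x_{n+1} for all n ∈ ℤ, and suppose x_n·x_{n+1} ≠ 1 for all n ∈ ℤ. Then x is periodic with period 3, i.e., x_{n+3} = x_n for all n ∈ ℤ. -/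
/-- The difference equation `x_{n-1} x_n x_{n+1} = x_{n-1} + x_n + x_{n+1}` (the case
`β = 2`, finite type `B₂`) is periodic with period 3. -/
theorem stmt_1 (x : ℤ → ℂ)
    (hrec : ∀ n : ℤ, x (n - 1) * x n * x (n + 1) = x (n - 1) + x n + x (n + 1))
    (hne : ∀ n : ℤ, x n * x (n + 1) ≠ 1) :
    ∀ n : ℤ, x (n + 3) = x n := by
  intro n
  have h₁ := hrec (n + 1)
  have h₂ := hrec (n + 2)
  rw [show n + 1 - 1 = n by ring, show n + 1 + 1 = n + 2 by ring] at h₁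
  rw [show n + 2 - 1 = n + 1 by ring, show n + 2 + 1 = n + 3 by ring] at h₂
  have h : x (n + 1) * x (n + 2) - 1 ≠ 0 := by
    have := hne (n + 1)
    rw [show n + 1 + 1 = n + 2 by ring] at this
    exact sub_ne_zero.mpr this
  apply mul_right_cancel₀ h
  linear_combination h₂ - h₁
end

section
/- Let x : ℤ → ℂ be a sequence satisfying x_{n-1}·x_n·x_{n+1} = x_{n-1} + (x_n)^2 + x_{n+1} for all n ∈ ℤ, and suppose x_n·x_{n+1} ≠ 1 for all n ∈ ℤ. Then x is periodic with period 4, i.e., x_{n+4} = x_n for all n ∈ ℤ. -/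
/-- Four consecutive terms `a, b, c, d` of the recurrence wrap around: `d, a, b` satisfy it too. -/
theorem recurrence_wraps_around {K : Type*} [Field K] {a b c d : K}
    (hab : a * b ≠ 1) (hbc : b * c ≠ 1)
    (hb : a * b * c = a + b ^ 2 + c) (hc : b * c * d = b + c ^ 2 + d) :
    d * (a * b - 1) = a ^ 2 + b := by
  have hu : a * b - 1 ≠ 0 := sub_ne_zero.mpr hab
  have hv : b * c - 1 ≠ 0 := sub_ne_zero.mpr hbc
  have hcu : c * (a * b - 1) = a + b ^ 2 := by linear_combination hb
  have hdv : d * (b * c - 1) = b + c ^ 2 := by linear_combination hc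
  have huv : (a * b - 1) * (b * c - 1) = b ^ 3 + 1 := by linear_combination b * hcu
  apply mul_right_cancel₀ (mul_ne_zero hu hv)
  linear_combination (a * b - 1) ^ 2 * hdv + (c * (a * b - 1) + a + b ^ 2) * hcu
    - (a ^ 2 + b) * huv


/-- The difference equation `x_{n-1} x_n x_{n+1} = x_{n-1} + x_n ^ 2 + x_{n+1}` (the case
`β = 3`, finite type `G₂`) is periodic with period 4. -/
theorem stmt_2 (x : ℤ → ℂ)
    (hrec : ∀ n : ℤ, x (n - 1) * x n * x (n + 1) = x (n - 1) + x n ^ 2 + x (n + 1))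
    (hne : ∀ n : ℤ, x n * x (n + 1) ≠ 1) :
    ∀ n : ℤ, x (n + 4) = x n := by
  intro n
  have h (m k l : ℤ) (hm : m - 1 = k) (hl : m + 1 = l) :
      x k * x m * x l = x k + x m ^ 2 + x l := by
    subst hm hl
    exact hrec m
  have hne₁ : x (n + 1) * x (n + 2) ≠ 1 := by simpa [add_assoc] using hne (n + 1)
  have hne₂ : x (n + 2) * x (n + 3) ≠ 1 := by simpa [add_assoc] using hne (n + 2)
  have h₁ := h (n + 1) n (n + 2) (by ring) (by ring)
  have h₂ := h (n + 2) (n + 1) (n + 3) (by ring) (by ring)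
  have h₃ := h (n + 3) (n + 2) (n + 4) (by ring) (by ring)
  apply mul_right_cancel₀ (sub_ne_zero.mpr hne₁)
  linear_combination recurrence_wraps_around hne₁ hne₂ h₂ h₃ - h₁
end

section
/- Let x : ℤ → ℂ satisfy x_{n-1}·x_n·x_{n+1} = x_{n-1} + 1 + x_{n+1} for all n ∈ ℤ, with x_n·x_{n+1} ≠ 1 for all n. Then the quantity K(x_n, x_{n+1}) := ((x_n^2·x_{n+1} + 1) + (x_n·x_{n+1}^2 + 1) + (x_n·x_{n+1} - 1)^2)/(x_n·x_{n+1} - 1) is independent of n, i.e., K(x_n, x_{n+1}) = K(x_{n+1}, x_{n+2}) for all n ∈ ℤ. -/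
/-- The conserved quantity of the difference equation with `β = 1` (type `A₂`). -/
theorem stmt_3 (x : ℤ → ℂ)
    (hrec : ∀ n : ℤ, x (n - 1) * x n * x (n + 1) = x (n - 1) + 1 + x (n + 1))
    (hne : ∀ n : ℤ, x n * x (n + 1) ≠ 1) :
    ∀ n : ℤ,
      ((x n ^ 2 * x (n + 1) + 1) + (x n * x (n + 1) ^ 2 + 1) + (x n * x (n + 1) - 1) ^ 2) /
          (x n * x (n + 1) - 1)
        = ((x (n + 1) ^ 2 * x (n + 2) + 1) + (x (n + 1) * x (n + 2) ^ 2 + 1) +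
            (x (n + 1) * x (n + 2) - 1) ^ 2) / (x (n + 1) * x (n + 2) - 1) := by
  intro n
  have h := hrec (n + 1)
  have h₁ := sub_ne_zero.mpr (hne n)
  have h₂ := sub_ne_zero.mpr (hne (n + 1))
  rw [show n + 1 - 1 = n by ring, show n + 1 + 1 = n + 2 by ring] at h
  rw [show n + 1 + 1 = n + 2 by ring] at h₂
  rw [div_eq_div_iff h₁ h₂]
  linear_combination x (n + 1) * (x n - x (n + 2)) * (1 + x (n + 1)) * h
end

section
/- Let x : ℤ → ℂ satisfy x_{n-1}·x_n·x_{n+1} = x_{n-1} + x_n + x_{n+1} for all n ∈ ℤ, with x_n·x_{n+1} ≠ 1 for all n. Then the quantity K(x_n, x_{n+1}) := (x_n + x_{n+1})·x_n·x_{n+1}/(x_n·x_{n+1} - 1) is independent of n, i.e., K(x_n, x_{n+1}) = K(x_{n+1}, x_{n+2}) for all n ∈ ℤ. -/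
/-- The conserved quantity of the difference equation with `β = 2` (type `B₂`). -/
theorem stmt_4 (x : ℤ → ℂ)
    (hrec : ∀ n : ℤ, x (n - 1) * x n * x (n + 1) = x (n - 1) + x n + x (n + 1))
    (hne : ∀ n : ℤ, x n * x (n + 1) ≠ 1) :
    ∀ n : ℤ,
      (x n + x (n + 1)) * x n * x (n + 1) / (x n * x (n + 1) - 1)
        = (x (n + 1) + x (n + 2)) * x (n + 1) * x (n + 2) / (x (n + 1) * x (n + 2) - 1) := by
  intro n
  have h := hrec (n + 1)
  rw [add_sub_cancel_right, show n + 1 + 1 = n + 2 by ring] at h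
  have h₁ := sub_ne_zero.mpr (hne n)
  have h₂ := sub_ne_zero.mpr (hne (n + 1))
  rw [show n + 1 + 1 = n + 2 by ring] at h₂
  -- Both sides equal `x n * x (n + 1) * x (n + 2)`.
  trans x n * x (n + 1) * x (n + 2)
  · rw [div_eq_iff h₁]
    linear_combination (-(x n * x (n + 1))) * h
  · rw [eq_div_iff h₂]
    linear_combination (x (n + 1) * x (n + 2)) * h
end

section
/- Let x : ℤ → ℂ satisfy x_{n-1}·x_n·x_{n+1} = x_{n-1} + (x_n)^2 + x_{n+1} for all n ∈ ℤ, with x_n·x_{n+1} ≠ 1 for all n. Then the quantity K(x_n, x_{n+1}) := ((x_n^2 + x_{n+1})·x_{n+1} + (x_n + x_{n+1}^2)·x_n)/(x_n·x_{n+1} - 1) is independent of n, i.e., K(x_n, x_{n+1}) = K(x_{n+1}, x_{n+2}) for all n ∈ ℤ. -/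
/-- The conserved quantity of the difference equation with `β = 3` (type `G₂`). -/
theorem stmt_5 (x : ℤ → ℂ)
    (hrec : ∀ n : ℤ, x (n - 1) * x n * x (n + 1) = x (n - 1) + x n ^ 2 + x (n + 1))
    (hne : ∀ n : ℤ, x n * x (n + 1) ≠ 1) :
    ∀ n : ℤ,
      ((x n ^ 2 + x (n + 1)) * x (n + 1) + (x n + x (n + 1) ^ 2) * x n) /
          (x n * x (n + 1) - 1)
        = ((x (n + 1) ^ 2 + x (n + 2)) * x (n + 2) + (x (n + 1) + x (n + 2) ^ 2) * x (n + 1)) /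
            (x (n + 1) * x (n + 2) - 1) := by
  intro n
  have h := hrec (n + 1)
  have hc := hne (n + 1)
  rw [add_sub_cancel_right] at h
  rw [show n + 1 + 1 = n + 2 by ring] at h hc
  rw [div_eq_div_iff (sub_ne_zero.mpr (hne n)) (sub_ne_zero.mpr hc)]
  linear_combination (x n - x (n + 2)) * (x (n + 1) + 1) * h
end

section
/- Let x : ℤ → ℂ satisfy x_{n-1}·x_n·x_{n+1} = x_{n-1} + (x_n)^3 + x_{n+1} for all n ∈ ℤ, with x_n·x_{n+1} ≠ 1 for all n. Then the quantity K(x_n, x_{n+1}) := (x_n^2 + x_{n+1}^2)/(x_n·x_{n+1} - 1) is independent of n, i.e., K(x_n, x_{n+1}) = K(x_{n+1}, x_{n+2}) for all n ∈ ℤ. -/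
/-- The conserved quantity of the difference equation with `β = 4` (affine type `A₂⁽²⁾`). -/
theorem stmt_6 (x : ℤ → ℂ)
    (hrec : ∀ n : ℤ, x (n - 1) * x n * x (n + 1) = x (n - 1) + x n ^ 3 + x (n + 1))
    (hne : ∀ n : ℤ, x n * x (n + 1) ≠ 1) :
    ∀ n : ℤ,
      (x n ^ 2 + x (n + 1) ^ 2) / (x n * x (n + 1) - 1)
        = (x (n + 1) ^ 2 + x (n + 2) ^ 2) / (x (n + 1) * x (n + 2) - 1) := by
  intro n
  have h := hrec (n + 1)
  have hne' := hne (n + 1)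
  rw [add_sub_cancel_right, add_assoc, one_add_one_eq_two] at h
  rw [add_assoc, one_add_one_eq_two] at hne'
  rw [div_eq_div_iff (sub_ne_zero.mpr (hne n)) (sub_ne_zero.mpr hne')]
  linear_combination (x n - x (n + 2)) * h
end

section
/- Let β ≥ 2 be a natural number and let u, v ∈ ℂ satisfy u·v ≠ 1 and v^β + 1 ≠ 0. Set u' := (u + v^{β-1})/(u·v - 1). Then u'·v ≠ 1 and (u'^2 + v^{β-2})/(u'·v - 1) = (u^2 + v^{β-2})/(u·v - 1); that is, the horizontal flip (u, v) ↦ ((u + v^{β-1})/(uv - 1), v) preserves the quantity (u^2 + v^{β-2})/(uv - 1). -/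
/-- The horizontal flip `(u, v) ↦ ((u + v^{β-1})/(uv - 1), v)` preserves the quantity
`(u² + v^{β-2})/(uv - 1)` for every `β ≥ 2`. -/
theorem stmt_7 (β : ℕ) (hβ : 2 ≤ β) (u v : ℂ) (huv : u * v ≠ 1)
    (hv : v ^ β + 1 ≠ 0) :
    (u + v ^ (β - 1)) / (u * v - 1) * v ≠ 1 ∧
    (((u + v ^ (β - 1)) / (u * v - 1)) ^ 2 + v ^ (β - 2)) /
        ((u + v ^ (β - 1)) / (u * v - 1) * v - 1)
      = (u ^ 2 + v ^ (β - 2)) / (u * v - 1) := by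
  obtain ⟨k, rfl⟩ := Nat.exists_eq_add_of_le' hβ
  have hD : u * v - 1 ≠ 0 := sub_ne_zero.mpr huv
  rw [show k + 2 - 1 = k + 1 by omega, Nat.add_sub_cancel]
  have key : (u + v ^ (k + 1)) / (u * v - 1) * v - 1 = (v ^ (k + 2) + 1) / (u * v - 1) := by
    rw [eq_div_iff hD, sub_mul, mul_right_comm, div_mul_cancel₀ _ hD]
    ring
  refine ⟨sub_ne_zero.mp (key ▸ div_ne_zero hv hD), ?_⟩
  rw [key, div_eq_div_iff (div_ne_zero hv hD) hD, div_pow, add_mul, div_mul_eq_mul_div,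
    mul_div_assoc', div_add' _ _ _ (pow_ne_zero 2 hD),
    div_eq_div_iff (pow_ne_zero 2 hD) hD]
  ring
end

section
/- Let u, v ∈ ℂ with u·v ≠ 1, and set u' := v and v' := (u + v^3)/(u·v - 1). If u'·v' ≠ 1, then (u'^2 + v'^2)/(u'·v' - 1) = (u^2 + v^2)/(u·v - 1); that is, the birational map φ̃_4 : (u, v) ↦ (v, (u + v^3)/(uv - 1)) preserves the quantity (u^2 + v^2)/(uv - 1). -/
/-- The birational map `φ̃₄ : (u, v) ↦ (v, (u + v³)/(uv - 1))` preserves the quantity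
`(u² + v²)/(uv - 1)`. -/
theorem stmt_8 (u v : ℂ) (huv : u * v ≠ 1)
    (huv' : v * ((u + v ^ 3) / (u * v - 1)) ≠ 1) :
    (v ^ 2 + ((u + v ^ 3) / (u * v - 1)) ^ 2) / (v * ((u + v ^ 3) / (u * v - 1)) - 1)
      = (u ^ 2 + v ^ 2) / (u * v - 1) := by
  have hD : u * v - 1 ≠ 0 := sub_ne_zero.mpr huv
  have hw : (u + v ^ 3) / (u * v - 1) * (u * v - 1) = u + v ^ 3 := div_mul_cancel₀ _ hD
  generalize (u + v ^ 3) / (u * v - 1) = w at *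
  rw [div_eq_div_iff (sub_ne_zero.mpr huv') hD]
  linear_combination (w - u) * hw
end

section
/- Let β be a natural number, and let u, v ∈ ℂ satisfy v ≠ 0 and u·v ≠ 1. Define x := u·v - 1 and y := v, then x' := (y^β + 1)/x and y' := (x' + 1)/y. Then y' = (u + v^{β-1})/(u·v - 1), and if y' ≠ 0 then (x' + 1)/y' = v. In other words, conjugating the birational map φ_β : (x, y) ↦ ((y^β + 1)/x, ((y^β + 1)/x + 1)/y) by the transformation π̃ : (u, v) ↦ (uv - 1, v) yields the map φ̃_β : (u, v) ↦ (v, (u + v^{β-1})/(uv - 1)). -/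
/-- Conjugating the birational map `φ_β : (x, y) ↦ ((y^β + 1)/x, ((y^β + 1)/x + 1)/y)` by the
transformation `π̃ : (u, v) ↦ (uv - 1, v)` yields the map
`φ̃_β : (u, v) ↦ (v, (u + v^{β-1})/(uv - 1))`.  Here `x = uv - 1`, `y = v`,
`x' = (y^β + 1)/x` and `y' = (x' + 1)/y`. -/
theorem stmt_9 (β : ℕ) (hβ : 1 ≤ β) (u v : ℂ) (hv : v ≠ 0) (huv : u * v ≠ 1) :
    ((v ^ β + 1) / (u * v - 1) + 1) / v = (u + v ^ (β - 1)) / (u * v - 1) ∧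
    (((v ^ β + 1) / (u * v - 1) + 1) / v ≠ 0 →
      ((v ^ β + 1) / (u * v - 1) + 1) / (((v ^ β + 1) / (u * v - 1) + 1) / v) = v) := by
  have hx : u * v - 1 ≠ 0 := sub_ne_zero.mpr huv
  have hpow : v ^ β = v ^ (β - 1) * v := (pow_sub_one_mul (by omega) v).symm
  refine ⟨?_, fun hy => div_div_cancel₀ (div_ne_zero_iff.mp hy).1⟩
  rw [hpow, div_add_one hx, div_div, div_eq_div_iff (mul_ne_zero hx hv) hx]
  ring
end

section
/- Let x, y ∈ ℂ with x ≠ 0, y ≠ 0, and x·y^2 ≠ 0. Define x' := (y^4 + 1)/x and y' := (x' + 1)/y, and assume x' ≠ 0 and y' ≠ 0. Then ((x' + 1)^2 + y'^4)/(x'·y'^2) = ((x + 1)^2 + y^4)/(x·y^2); that is, the birational map φ_4 preserves the quantity λ = ((x + 1)^2 + y^4)/(xy^2), so the quartic curve (x + 1)^2 + y^4 - λxy^2 = 0 is an invariant curve of φ_4. -/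
/-- The birational map `φ₄ : (x, y) ↦ (x', y')` with `x' = (y⁴ + 1)/x`, `y' = (x' + 1)/y`
preserves the quantity `λ = ((x + 1)² + y⁴)/(x y²)`, so the quartic curve
`(x + 1)² + y⁴ - λ x y² = 0` is an invariant curve of `φ₄`. -/
theorem stmt_11 (x y : ℂ) (hx : x ≠ 0) (hy : y ≠ 0) (hxy : x * y ^ 2 ≠ 0)
    (hx' : (y ^ 4 + 1) / x ≠ 0)
    (hy' : ((y ^ 4 + 1) / x + 1) / y ≠ 0) :
    (((y ^ 4 + 1) / x + 1) ^ 2 + (((y ^ 4 + 1) / x + 1) / y) ^ 4) /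
        ((y ^ 4 + 1) / x * ((((y ^ 4 + 1) / x + 1) / y)) ^ 2)
      = ((x + 1) ^ 2 + y ^ 4) / (x * y ^ 2) := by
  have hp : (y ^ 4 + 1) / x * x = y ^ 4 + 1 := div_mul_cancel₀ _ hx
  have hs : (y ^ 4 + 1) / x + 1 ≠ 0 := fun h => hy' (by rw [h, zero_div])
  generalize (y ^ 4 + 1) / x = p at *
  have hl : ((p + 1) ^ 2 + ((p + 1) / y) ^ 4) / (p * ((p + 1) / y) ^ 2)
      = (y ^ 4 + (p + 1) ^ 2) / (p * y ^ 2) := by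
    field_simp
  rw [hl, div_eq_div_iff (mul_ne_zero hx' (pow_ne_zero 2 hy)) hxy]
  linear_combination (y ^ 2 * (p - x)) * hp
end

section
/- Let β ≥ 4 be a natural number and let d_X, d_Y, d_Z be real numbers satisfying d_Z - d_Y > 0, d_Z - d_X > d_Z - d_Y, and 2(d_Z - d_Y) > d_Z - d_X. Define d_X' := (β+1)·d_Y, d_Y' := β·d_Y + d_Z, d_Z' := d_X + d_Y + (β-1)·d_Z. Then the new triple satisfies the same conditions: d_Z' - d_Y' > 0, d_Z' - d_X' > d_Z' - d_Y', and 2(d_Z' - d_Y') > d_Z' - d_X'. -/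
/-- Induction step in the proof that the singularity of `φ_β` at `[0 : y : 1]` is never
confined for `β ≥ 4`: the conditions `d_Z - d_Y > 0`, `d_Z - d_X > d_Z - d_Y` and
`2(d_Z - d_Y) > d_Z - d_X` are preserved by the linear recursion for the minimal degrees. -/
theorem stmt_14 (β : ℕ) (hβ : 4 ≤ β) (dX dY dZ : ℝ)
    (h1 : dZ - dY > 0) (h2 : dZ - dX > dZ - dY)
    (h3 : 2 * (dZ - dY) > dZ - dX) :
    ((dX + dY + ((β : ℝ) - 1) * dZ) - ((β : ℝ) * dY + dZ) > 0) ∧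
    ((dX + dY + ((β : ℝ) - 1) * dZ) - (((β : ℝ) + 1) * dY) >
      (dX + dY + ((β : ℝ) - 1) * dZ) - ((β : ℝ) * dY + dZ)) ∧
    (2 * ((dX + dY + ((β : ℝ) - 1) * dZ) - ((β : ℝ) * dY + dZ)) >
      (dX + dY + ((β : ℝ) - 1) * dZ) - (((β : ℝ) + 1) * dY)) := by
  have hb : (4 : ℝ) ≤ β := by exact_mod_cast hβ
  have key : 0 ≤ ((β : ℝ) - 4) * (dZ - dY) := mul_nonneg (by linarith) h1.le
  refine ⟨?_, ?_, ?_⟩ <;> linarith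
end

section
/- Let β ≥ 4 be a natural number and let d_X, d_Y, d_Z : ℕ → ℝ be the sequences defined by the initial values d_X(0) = β + 1, d_Y(0) = 2β - 1, d_Z(0) = β^2 - 2β + 2 and the recursion d_X(t+1) = (β+1)·d_Y(t), d_Y(t+1) = β·d_Y(t) + d_Z(t), d_Z(t+1) = d_X(t) + d_Y(t) + (β-1)·d_Z(t). Then for every t ∈ ℕ: 0 < d_X(t) < d_Y(t) < d_Z(t). -/
/-- The minimal degrees of the perturbation parameter `ε` in the homogeneous coordinates of the
iterates of `φ_β` (`β ≥ 4`), determined by the linear recursion with the stated initial values,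
satisfy `0 < d_X(t) < d_Y(t) < d_Z(t)` for every `t`; hence the singularity of `φ_β` at
`[0 : y : 1]` is never confined. -/
theorem stmt_15 (β : ℕ) (hβ : 4 ≤ β) (dX dY dZ : ℕ → ℝ)
    (hX0 : dX 0 = (β : ℝ) + 1) (hY0 : dY 0 = 2 * (β : ℝ) - 1)
    (hZ0 : dZ 0 = (β : ℝ) ^ 2 - 2 * (β : ℝ) + 2)
    (hX : ∀ t : ℕ, dX (t + 1) = ((β : ℝ) + 1) * dY t)
    (hY : ∀ t : ℕ, dY (t + 1) = (β : ℝ) * dY t + dZ t)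
    (hZ : ∀ t : ℕ, dZ (t + 1) = dX t + dY t + ((β : ℝ) - 1) * dZ t) :
    ∀ t : ℕ, 0 < dX t ∧ dX t < dY t ∧ dY t < dZ t := by
  have hb : (4 : ℝ) ≤ β := by exact_mod_cast hβ
  -- The gaps `u = dY - dX` and `v = dZ - dY` map to `v` and `(β - 2) v - u`,
  -- which preserves `0 < u ≤ v`.
  have key : ∀ t : ℕ, 0 < dX t ∧ 0 < dY t - dX t ∧ dY t - dX t ≤ dZ t - dY t := by
    intro t
    induction t with
    | zero =>
      rw [hX0, hY0, hZ0]
      refine ⟨by linarith, by linarith, by nlinarith⟩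
    | succ t ih =>
      obtain ⟨h1, h2, h3⟩ := ih
      rw [hX, hY, hZ]
      refine ⟨mul_pos (by linarith) (by linarith), by linarith, ?_⟩
      have h4 : 0 ≤ ((β : ℝ) - 4) * (dZ t - dY t) :=
        mul_nonneg (by linarith) (by linarith)
      linarith
  intro t
  obtain ⟨h1, h2, h3⟩ := key t
  exact ⟨h1, by linarith, by linarith⟩
end

section
/- Let β ≥ 5 be a natural number and let δ : ℕ → ℝ satisfy δ(0) = 1, δ(1) = β - 1, and δ(t+1) = (β - 2)·δ(t) - δ(t-1) for all t ≥ 1. Then the limit lim_{t→∞} (1/t)·log δ(t) exists and equals log((β + √(β(β - 4)))/2). In particular, the algebraic entropy of the birational map φ̃_β is positive for β ≥ 5. -/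
/-- A sequence squeezed between two positive multiples `ν ^ t` and `C * ν ^ t` of a geometric
sequence has exponential growth rate `log ν`. -/
theorem tendsto_inv_mul_log_of_geometric_bounds {ν C : ℝ} (hν : 0 < ν) (hC : 0 < C) {δ : ℕ → ℝ}
    (hlo : ∀ t, ν ^ t ≤ δ t) (hhi : ∀ t, δ t ≤ C * ν ^ t) :
    Filter.Tendsto (fun t : ℕ => (1 / (t : ℝ)) * Real.log (δ t)) Filter.atTop
      (nhds (Real.log ν)) := by
  have hlim : Filter.Tendsto (fun t : ℕ => Real.log C / (t : ℝ) + Real.log ν) Filter.atTop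
      (nhds (Real.log ν)) := by
    simpa using (tendsto_const_div_atTop_nhds_zero_nat (Real.log C)).add_const (Real.log ν)
  refine tendsto_of_tendsto_of_tendsto_of_le_of_le' tendsto_const_nhds hlim ?_ ?_
  · filter_upwards [Filter.eventually_gt_atTop 0] with t ht
    have ht' : (0 : ℝ) < t := by exact_mod_cast ht
    have h := Real.log_le_log (pow_pos hν t) (hlo t)
    rw [Real.log_pow] at h
    rw [one_div_mul_eq_div, le_div_iff₀ ht']
    linarith
  · filter_upwards [Filter.eventually_gt_atTop 0] with t ht
    have ht' : (0 : ℝ) < t := by exact_mod_cast ht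
    have h := Real.log_le_log ((pow_pos hν t).trans_le (hlo t)) (hhi t)
    rw [Real.log_mul hC.ne' (pow_pos hν t).ne', Real.log_pow] at h
    rw [one_div_mul_eq_div, div_le_iff₀ ht', add_mul, div_mul_cancel₀ _ ht'.ne']
    linarith

/-- A solution of a second order linear recurrence with characteristic roots `ν` and `μ`
satisfies a first order recurrence with geometric forcing term. -/
theorem succ_eq_of_characteristic_roots {ν μ : ℝ} {δ : ℕ → ℝ}
    (hrec : ∀ t, δ (t + 2) = (ν + μ) * δ (t + 1) - ν * μ * δ t) (t : ℕ) :
    δ (t + 1) = μ * δ t + ν ^ t * (δ 1 - μ * δ 0) := by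
  induction t with
  | zero => simp
  | succ t ih =>
    rw [hrec t, pow_succ]
    linear_combination ν * ih

/-- The algebraic entropy of the birational map `φ̃_β` for `β ≥ 5`: the limit
`lim_{t→∞} (1/t) log δ(t)` exists and equals `log ν₊` with
`ν₊ = (β - 2 + √(β(β-4)))/2`; in particular the algebraic entropy is positive. -/
theorem stmt_18 (β : ℕ) (hβ : 5 ≤ β) (δ : ℕ → ℝ)
    (h0 : δ 0 = 1) (h1 : δ 1 = (β : ℝ) - 1)
    (hrec : ∀ t : ℕ, δ (t + 2) = ((β : ℝ) - 2) * δ (t + 1) - δ t) :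
    Filter.Tendsto
      (fun t : ℕ => (1 / (t : ℝ)) * Real.log (δ t)) Filter.atTop
      (nhds (Real.log (((β : ℝ) - 2 + Real.sqrt ((β : ℝ) * ((β : ℝ) - 4))) / 2))) ∧
    0 < Real.log (((β : ℝ) - 2 + Real.sqrt ((β : ℝ) * ((β : ℝ) - 4))) / 2) := by
  obtain ⟨ν, hν⟩ : ∃ ν : ℝ, ν = ((β : ℝ) - 2 + Real.sqrt ((β : ℝ) * ((β : ℝ) - 4))) / 2 :=
    ⟨_, rfl⟩
  rw [← hν]
  have hβ' : (5 : ℝ) ≤ β := by exact_mod_cast hβ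
  have hs : Real.sqrt ((β : ℝ) * ((β : ℝ) - 4)) ^ 2 = (β : ℝ) * ((β : ℝ) - 4) :=
    Real.sq_sqrt (by nlinarith)
  have hs1 : 1 ≤ Real.sqrt ((β : ℝ) * ((β : ℝ) - 4)) :=
    Real.one_le_sqrt.mpr (by nlinarith)
  have hν2 : 2 ≤ ν := by rw [hν]; linarith
  have hνpos : 0 < ν := by linarith
  refine ⟨?_, Real.log_pos (by linarith)⟩
  obtain ⟨μ, hμ⟩ : ∃ μ : ℝ, μ = (β : ℝ) - 2 - ν := ⟨_, rfl⟩
  have hprod : ν * μ = 1 := by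
    rw [hμ, hν]
    linear_combination (-1 / 4) * hs
  have hμ0 : 0 < μ := by
    by_contra! h
    nlinarith
  have hμ1 : μ ≤ 1 := by nlinarith
  have hstep : ∀ t, δ (t + 1) = μ * δ t + ν ^ t * (ν + 1) := by
    intro t
    rw [succ_eq_of_characteristic_roots (ν := ν) (μ := μ) (δ := δ) (fun t => ?_) t, h0, h1, hμ]
    · ring
    · rw [hrec t, hprod, hμ]
      ring
  have hlo : ∀ t, ν ^ t ≤ δ t := by
    intro t
    induction t with
    | zero => simp [h0]
    | succ t ih =>
      have hp := pow_pos hνpos t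
      have hm := mul_pos hμ0 (hp.trans_le ih)
      rw [hstep t, pow_succ]
      linarith
  have hhi : ∀ t, δ t ≤ 3 * ν ^ t := by
    intro t
    induction t with
    | zero => norm_num [h0]
    | succ t ih =>
      have hp := pow_pos hνpos t
      have hm : μ * δ t ≤ δ t := mul_le_of_le_one_left (hp.le.trans (hlo t)) hμ1
      rw [hstep t, pow_succ]
      nlinarith
  exact tendsto_inv_mul_log_of_geometric_bounds hνpos three_pos hlo hhi
end

section
/- Let β ≥ 5 be a natural number and let δ : ℕ → ℝ satisfy δ(0) = 1, δ(1) = β - 1, and δ(t+1) = (β - 2)·δ(t) - δ(t-1) for all t ≥ 1. Then for every t ≥ 1, δ(t) = ((β - 2)/2)^t · ( (β/(β - 2)) · Σ_{m=0}^{⌊(t-1)/2⌋} C(t, 2m+1)·(β(β - 4)/(β - 2)^2)^m + Σ_{m=0}^{⌊t/2⌋} C(t, 2m)·(β(β - 4)/(β - 2)^2)^m ), where C(t, k) denotes the binomial coefficient. -/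
/-- Terms beyond `t / 2` do not contribute to the even binomial sum. -/
theorem sum_choose_even_eq {R : Type*} [CommSemiring R] (x : R) {t N : ℕ} (hN : t / 2 + 1 ≤ N) :
    ∑ m ∈ Finset.range (t / 2 + 1), (t.choose (2 * m) : R) * x ^ m =
      ∑ m ∈ Finset.range N, (t.choose (2 * m) : R) * x ^ m := by
  refine Finset.sum_subset (Finset.range_mono hN) fun m _ hm => ?_
  rw [Finset.mem_range] at hm
  rw [Nat.choose_eq_zero_of_lt (by omega), Nat.cast_zero, zero_mul]

/-- Terms beyond `(t - 1) / 2` do not contribute to the odd binomial sum. -/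
theorem sum_choose_odd_eq {R : Type*} [CommSemiring R] (x : R) {t N : ℕ}
    (hN : (t - 1) / 2 + 1 ≤ N) :
    ∑ m ∈ Finset.range ((t - 1) / 2 + 1), (t.choose (2 * m + 1) : R) * x ^ m =
      ∑ m ∈ Finset.range N, (t.choose (2 * m + 1) : R) * x ^ m := by
  refine Finset.sum_subset (Finset.range_mono hN) fun m _ hm => ?_
  rw [Finset.mem_range] at hm
  rw [Nat.choose_eq_zero_of_lt (by omega), Nat.cast_zero, zero_mul]

/-- Pascal's rule for the odd binomial sum. -/
theorem sum_choose_odd_succ {R : Type*} [CommSemiring R] (x : R) (t : ℕ) :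
    ∑ m ∈ Finset.range ((t + 1 - 1) / 2 + 1), ((t + 1).choose (2 * m + 1) : R) * x ^ m =
      ∑ m ∈ Finset.range (t / 2 + 1), (t.choose (2 * m) : R) * x ^ m +
        ∑ m ∈ Finset.range ((t - 1) / 2 + 1), (t.choose (2 * m + 1) : R) * x ^ m := by
  rw [sum_choose_odd_eq x (N := t + 1) (by omega), sum_choose_odd_eq x (N := t + 1) (by omega),
    sum_choose_even_eq x (N := t + 1) (by omega), ← Finset.sum_add_distrib]
  refine Finset.sum_congr rfl fun m _ => ?_
  rw [Nat.choose_succ_succ', Nat.cast_add, add_mul]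

/-- Pascal's rule for the even binomial sum. -/
theorem sum_choose_even_succ {R : Type*} [CommSemiring R] (x : R) (t : ℕ) :
    ∑ m ∈ Finset.range ((t + 1) / 2 + 1), ((t + 1).choose (2 * m) : R) * x ^ m =
      x * ∑ m ∈ Finset.range ((t - 1) / 2 + 1), (t.choose (2 * m + 1) : R) * x ^ m +
        ∑ m ∈ Finset.range (t / 2 + 1), (t.choose (2 * m) : R) * x ^ m := by
  rw [sum_choose_even_eq x (N := t + 1 + 1) (by omega),
    sum_choose_odd_eq x (N := t + 1) (by omega),
    sum_choose_even_eq x (t := t) (N := t + 1 + 1) (by omega),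
    Finset.sum_range_succ', Finset.sum_range_succ' _ (t + 1), ← add_assoc, Finset.mul_sum,
    ← Finset.sum_add_distrib]
  congr 1
  · refine Finset.sum_congr rfl fun m _ => ?_
    rw [show 2 * (m + 1) = 2 * m + 1 + 1 by ring, Nat.choose_succ_succ', Nat.cast_add]
    ring
  · simp

/-- Square-root-free closed form of the homogeneous degree `δ(t)` of the `t`-th iterate of the
birational map `φ̃_β` for `β ≥ 5`, obtained by binomial expansion of `ν₊ᵗ ± ν₋ᵗ`. -/
theorem stmt_19 (β : ℕ) (hβ : 5 ≤ β) (δ : ℕ → ℝ)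
    (h0 : δ 0 = 1) (h1 : δ 1 = (β : ℝ) - 1)
    (hrec : ∀ t : ℕ, δ (t + 2) = ((β : ℝ) - 2) * δ (t + 1) - δ t) :
    ∀ t : ℕ, 1 ≤ t →
      δ t = (((β : ℝ) - 2) / 2) ^ t *
        (((β : ℝ) / ((β : ℝ) - 2)) *
            ∑ m ∈ Finset.range ((t - 1) / 2 + 1),
              (t.choose (2 * m + 1) : ℝ) *
                ((β : ℝ) * ((β : ℝ) - 4) / ((β : ℝ) - 2) ^ 2) ^ m +
          ∑ m ∈ Finset.range (t / 2 + 1),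
            (t.choose (2 * m) : ℝ) *
              ((β : ℝ) * ((β : ℝ) - 4) / ((β : ℝ) - 2) ^ 2) ^ m) := by
  have hβ' : (5 : ℝ) ≤ β := by exact_mod_cast hβ
  have hne : (β : ℝ) - 2 ≠ 0 := by linarith
  suffices h : ∀ t : ℕ, _ from fun t _ => h t
  intro t
  induction t using Nat.twoStepInduction with
  | zero => simp [h0]
  | one =>
    simp only [h1, Nat.sub_self, Nat.zero_div, Nat.reduceDiv, zero_add, Finset.sum_range_one]
    norm_num
    field_simp
    ring
  | more t ih ih' =>
    rw [hrec, ih, ih', sum_choose_odd_succ _ (t + 1), sum_choose_even_succ _ (t + 1),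
      sum_choose_odd_succ _ t, sum_choose_even_succ _ t]
    generalize ∑ m ∈ Finset.range ((t - 1) / 2 + 1), (t.choose (2 * m + 1) : ℝ) *
      ((β : ℝ) * ((β : ℝ) - 4) / ((β : ℝ) - 2) ^ 2) ^ m = O
    generalize ∑ m ∈ Finset.range (t / 2 + 1), (t.choose (2 * m) : ℝ) *
      ((β : ℝ) * ((β : ℝ) - 4) / ((β : ℝ) - 2) ^ 2) ^ m = E
    rw [pow_succ, pow_succ]
    field_simp
    ring
end
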